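/- arXiv:2510.17029 — 2 statements merged into one kernel-verified Lean document; each statement's English description precedes it below -/
import Mathlib

section
/- Let n ≥ 12 be an integer divisible by 6, and let d be the least nonnegative integer such that ⌊(d² + 6d)/12⌋ ≥ (n−6)²/36. Then there exists a nonzero homogeneous polynomial G ∈ ℂ[x,y,z] of degree d + 3 with G(a,b,1) = 0 for every (a,b) ∈ ℬ_n, and which is skew-invariant for the dihedral action: G(−(1/2)x − (√3/2)y, (√3/2)x − (1/2)y, z) = G(x,y,z) and G(x,−y,z) = −G(x,y,z). -/
open Complex

/-- `P n j = exp(2πij/n)`. -/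
noncomputable def Ppt (n j : ℕ) : ℂ := Complex.exp (2 * Real.pi * Complex.I * j / n)

/-- `Q n j = -exp(-4πij/n)`. -/
noncomputable def Qpt (n j : ℕ) : ℂ := -Complex.exp (-(4 * Real.pi * Complex.I * j) / n)

open scoped Classical in
/-- The `j`-th line of the Böröczky configuration: the line through `P n j` and
`Q n j` if they are distinct, and the tangent line to the unit circle at `P n j`
otherwise (identifying ℝ² with ℂ). -/
noncomputable def Bline (n j : ℕ) : Set ℂ :=
  if Ppt n j = Qpt n j then
    {z : ℂ | (z * (starRingEnd ℂ) (Ppt n j)).re = 1}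
  else
    {z : ℂ | ((z - Ppt n j) * (starRingEnd ℂ) (Qpt n j - Ppt n j)).im = 0}

/-- The set of triple points of the Böröczky configuration: points lying on at
least three of the lines `L_0, …, L_{n-1}`. -/
def TriplePts (n : ℕ) : Set ℂ :=
  {z : ℂ | 3 ≤ ({j : ℕ | j < n ∧ z ∈ Bline n j} : Set ℕ).ncard}

open MvPolynomial

/-- The point of ℂ³ corresponding to a planar point `p` (viewed as the
projective point `[Re p : Im p : 1]`). -/
noncomputable def projPt (p : ℂ) : Fin 3 → ℂ := ![(p.re : ℂ), (p.im : ℂ), 1]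

/-- `F` vanishes to order at least `m` at the planar point `p`: every partial
derivative of `F` of total order `< m` vanishes at `(Re p, Im p, 1)`. -/
def VanishesToOrder (F : MvPolynomial (Fin 3) ℂ) (m : ℕ) (p : ℂ) : Prop :=
  ∀ d : Fin 3 → ℕ, d 0 + d 1 + d 2 < m →
    eval (projPt p)
      ((fun G => pderiv (0 : Fin 3) G)^[d 0]
        ((fun G => pderiv (1 : Fin 3) G)^[d 1]
          ((fun G => pderiv (2 : Fin 3) G)^[d 2] F))) = 0

open scoped Classical in
/-- The defining linear form of the `j`-th configuration line: the determinant
of the matrix with rows `(x,y,z)`, `(Re P_j, Im P_j, 1)`, `(Re Q_j, Im Q_j, 1)`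
if `P_j ≠ Q_j`, and `(Re P_j)·x + (Im P_j)·y - z` if `P_j = Q_j`. -/
noncomputable def ell (n j : ℕ) : MvPolynomial (Fin 3) ℂ :=
  if Ppt n j = Qpt n j then
    C (((Ppt n j).re : ℂ)) * X 0 + C (((Ppt n j).im : ℂ)) * X 1 - X 2
  else
    C ((((Ppt n j).im - (Qpt n j).im : ℝ) : ℂ)) * X 0 -
      C ((((Ppt n j).re - (Qpt n j).re : ℝ) : ℂ)) * X 1 +
      C ((((Ppt n j).re * (Qpt n j).im - (Ppt n j).im * (Qpt n j).re : ℝ) : ℂ)) * X 2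

/-- The ℂ-algebra endomorphism of ℂ[x,y,z] given by
`x ↦ -(1/2)x - (√3/2)y`, `y ↦ (√3/2)x - (1/2)y`, `z ↦ z`. -/
noncomputable def rotSub : MvPolynomial (Fin 3) ℂ →ₐ[ℂ] MvPolynomial (Fin 3) ℂ :=
  aeval ![C (-(1/2) : ℂ) * X 0 - C ((Real.sqrt 3 / 2 : ℝ) : ℂ) * X 1,
          C ((Real.sqrt 3 / 2 : ℝ) : ℂ) * X 0 - C ((1/2) : ℂ) * X 1,
          X 2]

/-- The ℂ-algebra endomorphism of ℂ[x,y,z] given by `x ↦ x`, `y ↦ -y`, `z ↦ z`. -/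
noncomputable def reflSub : MvPolynomial (Fin 3) ℂ →ₐ[ℂ] MvPolynomial (Fin 3) ℂ :=
  aeval ![X 0, -X 1, X 2]

/-- The form `x² + y²`. -/
noncomputable def normForm : MvPolynomial (Fin 3) ℂ := X 0 ^ 2 + X 1 ^ 2

/-- The form `Re (x + iy)³ = x³ - 3xy²`. -/
noncomputable def reCubeForm : MvPolynomial (Fin 3) ℂ := X 0 ^ 3 - 3 * X 0 * X 1 ^ 2

/-- The form `Im (x + iy)³ = 3x²y - y³`, the product of the three mirrors. -/
noncomputable def imCubeForm : MvPolynomial (Fin 3) ℂ := 3 * X 0 ^ 2 * X 1 - X 1 ^ 3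

/-- The exponents `(b, c)` of the invariants `z ^ (d - 2b - 3c) (x² + y²)ᵇ (x³ - 3xy²)ᶜ` of
degree `d`. -/
def invExponents (d : ℕ) : Finset (ℕ × ℕ) :=
  (Finset.range (d + 1) ×ˢ Finset.range (d + 1)).filter fun e => 2 * e.1 + 3 * e.2 ≤ d

/-- The dihedral invariant form of degree `d` with coefficients `c`. -/
noncomputable def invForm (d : ℕ) (c : ℕ × ℕ → ℂ) : MvPolynomial (Fin 3) ℂ :=
  ∑ e ∈ invExponents d,
    C (c e) * (X 2 ^ (d - 2 * e.1 - 3 * e.2) * normForm ^ e.1 * reCubeForm ^ e.2)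

/-- Representatives of the exponents `(a, b, -a-b)` of the free orbits of triple points. -/
def orbitExponents (m : ℕ) : Finset (ℕ × ℕ) :=
  (Finset.range (2 * m) ×ˢ Finset.range (2 * m)).filter fun e =>
    0 < e.1 ∧ e.1 < e.2 ∧ e.1 + e.2 < 2 * m

/-- The sum `ζᵃ + ζᵇ + ζ⁻ᵃ⁻ᵇ`. -/
noncomputable def orbitPt (ζ : ℂ) (e : ℕ × ℕ) : ℂ :=
  ζ ^ (e.1 : ℤ) + ζ ^ (e.2 : ℤ) + ζ ^ (-(e.1 : ℤ) - e.2)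

lemma sum_half_eq (d : ℕ) :
    (d ^ 2 + 6 * d) / 12 + 1 = ∑ c ∈ Finset.range (d / 3 + 1), ((d - 3 * c) / 2 + 1) := by
  induction d using Nat.strong_induction_on with
  | _ d ih =>
    rcases lt_or_ge d 6 with h | h
    · interval_cases d <;> decide
    · obtain ⟨k, rfl⟩ := Nat.exists_eq_add_of_le' h
      have h1 : (k + 6) / 3 + 1 = k / 3 + 1 + 1 + 1 := by omega
      rw [h1, Finset.sum_range_succ', Finset.sum_range_succ']
      have h2 : ∀ c, (k + 6 - 3 * (c + 1 + 1)) = k - 3 * c := fun c => by omega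
      simp only [h2, ← ih k (by omega)]
      have h3 : (k + 6) ^ 2 + 6 * (k + 6) = k ^ 2 + 6 * k + 12 * (k + 6) := by ring
      rw [h3]
      omega

lemma card_invExponents (d : ℕ) : (d ^ 2 + 6 * d) / 12 + 1 ≤ (invExponents d).card := by
  rw [sum_half_eq]
  have h : ∑ c ∈ Finset.range (d / 3 + 1), ((d - 3 * c) / 2 + 1) =
      ((Finset.range (d / 3 + 1)).sigma fun c => Finset.range ((d - 3 * c) / 2 + 1)).card := by
    simp
  rw [h]
  refine Finset.card_le_card_of_injOn (fun x => (x.2, x.1)) ?_ ?_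
  · rintro ⟨c, b⟩ hx
    simp [invExponents] at hx ⊢
    omega
  · rintro ⟨c, b⟩ - ⟨c', b'⟩ - h
    simp only [Prod.mk.injEq] at h
    obtain ⟨rfl, rfl⟩ := h
    rfl

lemma card_orbitExponents (m : ℕ) : (orbitExponents m).card ≤ (m - 1) ^ 2 := by
  have h : (Finset.range (m - 1) ×ˢ Finset.range (m - 1)).card = (m - 1) ^ 2 := by
    simp [sq]
  rw [← h]
  refine Finset.card_le_card_of_injOn (fun e => (min (e.2 - e.1 - 1) (m - 1 - e.1),
    min (2 * (m - 1 - e.1) - (e.2 - e.1 - 1)) (m - 1 - e.1))) ?_ ?_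
  · rintro ⟨a, b⟩ hx
    simp [orbitExponents] at hx ⊢
    omega
  · rintro ⟨a, b⟩ hx ⟨a', b'⟩ hx' h
    simp [orbitExponents] at hx hx' h ⊢
    omega

lemma eval_normForm (x y w : ℂ) : eval ![x, y, w] normForm = x ^ 2 + y ^ 2 := by
  simp [normForm]

lemma eval_reCubeForm (x y w : ℂ) : eval ![x, y, w] reCubeForm = x ^ 3 - 3 * x * y ^ 2 := by
  simp [reCubeForm]

lemma eval_imCubeForm (x y w : ℂ) : eval ![x, y, w] imCubeForm = 3 * x ^ 2 * y - y ^ 3 := by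
  simp [imCubeForm]

lemma eval_invForm (d : ℕ) (c : ℕ × ℕ → ℂ) (x y : ℂ) :
    eval ![x, y, 1] (invForm d c) =
      ∑ e ∈ invExponents d, c e * ((x ^ 2 + y ^ 2) ^ e.1 * (x ^ 3 - 3 * x * y ^ 2) ^ e.2) := by
  simp [invForm, eval_normForm, eval_reCubeForm]

lemma exists_normForm_reCubeForm_eq (u v : ℂ) :
    ∃ x y : ℂ, x ^ 2 + y ^ 2 = u ∧ x ^ 3 - 3 * x * y ^ 2 = v := by
  suffices h : ∃ p q : ℂ, p * q = u ∧ p ^ 3 + q ^ 3 = 2 * v by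
    obtain ⟨p, q, h1, h2⟩ := h
    refine ⟨(p + q) / 2, (p - q) / (2 * I), ?_, ?_⟩
    · rw [← h1, div_pow, div_pow, mul_pow, I_sq]; ring
    · rw [div_pow, div_pow, mul_pow, I_sq]; linear_combination h2 / 2
  obtain ⟨s, hs⟩ := IsAlgClosed.exists_pow_nat_eq (v ^ 2 - u ^ 3) (n := 2) (by norm_num)
  by_cases hT : v + s = 0
  · have hu : u = 0 := by
      have : u ^ 3 = 0 := by linear_combination (v - s) * hT + hs
      simpa using this
    obtain ⟨p, hp⟩ := IsAlgClosed.exists_pow_nat_eq (2 * v) (n := 3) (by norm_num)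
    exact ⟨p, 0, by simp [hu], by simp [hp]⟩
  · obtain ⟨p, hp⟩ := IsAlgClosed.exists_pow_nat_eq (v + s) (n := 3) (by norm_num)
    have hp0 : p ≠ 0 := by
      rintro rfl
      exact hT (by simpa using hp.symm)
    refine ⟨p, u / p, by field_simp, ?_⟩
    rw [div_pow, hp]
    field_simp
    linear_combination hs

lemma coeff_eq_zero_of_invForm_eq_zero {d : ℕ} {c : ℕ × ℕ → ℂ} (h : invForm d c = 0) :
    ∀ e ∈ invExponents d, c e = 0 := by
  let f : ℕ × ℕ → (Fin 2 →₀ ℕ) := fun e => Finsupp.single 0 e.1 + Finsupp.single 1 e.2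
  have hf : Function.Injective f := by
    intro e e' h
    have h0 := DFunLike.congr_fun h 0
    have h1 := DFunLike.congr_fun h 1
    simp [f] at h0 h1
    exact Prod.ext h0 h1
  have hQ : ∑ e ∈ invExponents d, monomial (f e) (c e) = 0 := by
    refine MvPolynomial.funext fun w => ?_
    obtain ⟨x, y, hx, hy⟩ := exists_normForm_reCubeForm_eq (w 0) (w 1)
    have := eval_invForm d c x y
    rw [h, hx, hy, map_zero] at this
    rw [map_sum, map_zero, this]
    refine Finset.sum_congr rfl fun e _ => ?_
    rw [eval_monomial, Finsupp.prod_add_index' (by simp) (by simp [pow_add])]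
    simp
  intro e he
  have := congrArg (coeff (f e)) hQ
  rw [coeff_sum, coeff_zero] at this
  simpa [coeff_monomial, hf.eq_iff, he] using this

lemma isHomogeneous_normForm : normForm.IsHomogeneous 2 :=
  (isHomogeneous_X_pow _ _).add (isHomogeneous_X_pow _ _)

lemma isHomogeneous_reCubeForm : reCubeForm.IsHomogeneous 3 := by
  refine (isHomogeneous_X_pow _ _).sub ?_
  have := ((isHomogeneous_C (Fin 3) (3 : ℂ)).mul (isHomogeneous_X ℂ 0)).mul
    (isHomogeneous_X_pow (R := ℂ) (1 : Fin 3) 2)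
  rwa [map_ofNat] at this

lemma isHomogeneous_imCubeForm : imCubeForm.IsHomogeneous 3 := by
  refine IsHomogeneous.sub ?_ (isHomogeneous_X_pow _ _)
  have := ((isHomogeneous_C (Fin 3) (3 : ℂ)).mul (isHomogeneous_X_pow (R := ℂ) (0 : Fin 3) 2)).mul
    (isHomogeneous_X ℂ 1)
  rwa [map_ofNat] at this

lemma isHomogeneous_invForm (d : ℕ) (c : ℕ × ℕ → ℂ) : (invForm d c).IsHomogeneous d := by
  refine IsHomogeneous.sum _ _ _ fun e he => ?_
  have h := (isHomogeneous_C (Fin 3) (c e)).mul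
    (((isHomogeneous_X_pow (R := ℂ) (2 : Fin 3) (d - 2 * e.1 - 3 * e.2)).mul
      (isHomogeneous_normForm.pow e.1)).mul (isHomogeneous_reCubeForm.pow e.2))
  have hd : 0 + (d - 2 * e.1 - 3 * e.2 + 2 * e.1 + 3 * e.2) = d := by
    simp [invExponents] at he
    omega
  rwa [hd] at h

lemma imCubeForm_ne_zero : imCubeForm ≠ 0 := by
  intro h
  have := eval_imCubeForm 0 1 0
  rw [h] at this
  simp at this

lemma C_half_sqrt_three_sq :
    (C ((Real.sqrt 3 / 2 : ℝ) : ℂ) : MvPolynomial (Fin 3) ℂ) ^ 2 = C (3 / 4) := by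
  rw [← C_pow, ← Complex.ofReal_pow, div_pow, Real.sq_sqrt (by norm_num)]
  norm_num

lemma four_mul_C_three_quarters : (4 : MvPolynomial (Fin 3) ℂ) * C (3 / 4) = 3 := by
  have : (4 : MvPolynomial (Fin 3) ℂ) = C 4 := (map_ofNat C 4).symm
  rw [this, ← C_mul, show (4 : ℂ) * (3 / 4) = 3 by norm_num, map_ofNat]

lemma two_mul_C_half : (2 : MvPolynomial (Fin 3) ℂ) * C (1 / 2) = 1 := by
  have : (2 : MvPolynomial (Fin 3) ℂ) = C 2 := (map_ofNat C 2).symm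
  rw [this, ← C_mul]
  norm_num

lemma rotSub_X_two : rotSub (X 2) = X 2 := by simp [rotSub]

lemma eight_ne_zero : (8 : MvPolynomial (Fin 3) ℂ) ≠ 0 := by norm_num

lemma rotSub_normForm : rotSub normForm = normForm := by
  simp only [rotSub, normForm, map_add, map_pow, aeval_X, Matrix.cons_val, C_neg]
  have h := C_half_sqrt_three_sq
  have h3 := four_mul_C_three_quarters
  have h2 := two_mul_C_half
  generalize (C ((Real.sqrt 3 / 2 : ℝ) : ℂ) : MvPolynomial (Fin 3) ℂ) = s at *
  generalize (C (1 / 2) : MvPolynomial (Fin 3) ℂ) = r at *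
  generalize (C (3 / 4) : MvPolynomial (Fin 3) ℂ) = q at *
  have h4 : r ^ 2 + s ^ 2 = 1 := by
    apply mul_left_cancel₀ eight_ne_zero
    linear_combination 8 * h + 2 * h3 + (4 * r + 2) * h2
  linear_combination (X 0 ^ 2 + X 1 ^ 2) * h4

lemma rotSub_cube_coeffs :
    let s : MvPolynomial (Fin 3) ℂ := C ((Real.sqrt 3 / 2 : ℝ) : ℂ)
    let r : MvPolynomial (Fin 3) ℂ := C (1 / 2)
    3 * r * s ^ 2 - r ^ 3 = 1 ∧ 3 * r ^ 2 * s - s ^ 3 = 0 := by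
  have h := C_half_sqrt_three_sq
  have h3 := four_mul_C_three_quarters
  have h2 := two_mul_C_half
  generalize (C ((Real.sqrt 3 / 2 : ℝ) : ℂ) : MvPolynomial (Fin 3) ℂ) = s at *
  generalize (C (1 / 2) : MvPolynomial (Fin 3) ℂ) = r at *
  generalize (C (3 / 4) : MvPolynomial (Fin 3) ℂ) = q at *
  intro s' r'
  have h4 : 4 * s ^ 2 = 3 := by linear_combination 4 * h + h3
  have h5 : 4 * r ^ 2 = 1 := by linear_combination (2 * r + 1) * h2
  constructor
  · apply mul_left_cancel₀ eight_ne_zero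
    linear_combination 6 * r * h4 - 2 * r * h5 + 8 * h2
  · apply mul_left_cancel₀ eight_ne_zero
    linear_combination 6 * s * h5 - 2 * s * h4

lemma rotSub_reCubeForm : rotSub reCubeForm = reCubeForm := by
  simp only [rotSub, reCubeForm, map_sub, map_mul, map_pow, aeval_X, Matrix.cons_val, C_neg,
    map_ofNat]
  obtain ⟨h1, h2⟩ := rotSub_cube_coeffs
  generalize (C ((Real.sqrt 3 / 2 : ℝ) : ℂ) : MvPolynomial (Fin 3) ℂ) = s at *
  generalize (C (1 / 2) : MvPolynomial (Fin 3) ℂ) = r at *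
  linear_combination (X 0 ^ 3 - 3 * X 0 * X 1 ^ 2) * h1 -
    (3 * X 0 ^ 2 * X 1 - X 1 ^ 3) * h2

lemma rotSub_imCubeForm : rotSub imCubeForm = imCubeForm := by
  simp only [rotSub, imCubeForm, map_sub, map_mul, map_pow, aeval_X, Matrix.cons_val, C_neg,
    map_ofNat]
  obtain ⟨h1, h2⟩ := rotSub_cube_coeffs
  generalize (C ((Real.sqrt 3 / 2 : ℝ) : ℂ) : MvPolynomial (Fin 3) ℂ) = s at *
  generalize (C (1 / 2) : MvPolynomial (Fin 3) ℂ) = r at *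
  linear_combination (X 0 ^ 3 - 3 * X 0 * X 1 ^ 2) * h2 +
    (3 * X 0 ^ 2 * X 1 - X 1 ^ 3) * h1

lemma rotSub_invForm (d : ℕ) (c : ℕ × ℕ → ℂ) : rotSub (invForm d c) = invForm d c := by
  simp only [invForm, map_sum, map_mul, map_pow, rotSub_normForm, rotSub_reCubeForm,
    rotSub_X_two, algHom_C, algebraMap_eq]

lemma reflSub_imCubeForm : reflSub imCubeForm = -imCubeForm := by
  simp only [reflSub, imCubeForm, map_sub, map_mul, map_pow, aeval_X, Matrix.cons_val, map_ofNat]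
  ring

lemma reflSub_invForm (d : ℕ) (c : ℕ × ℕ → ℂ) : reflSub (invForm d c) = invForm d c := by
  have h1 : reflSub normForm = normForm := by simp [reflSub, normForm]
  have h2 : reflSub reCubeForm = reCubeForm := by
    simp only [reflSub, reCubeForm, map_sub, map_mul, map_pow, aeval_X, Matrix.cons_val, map_ofNat]
    ring
  have h3 : reflSub (X 2) = X 2 := by simp [reflSub]
  simp only [invForm, map_sum, map_mul, map_pow, h1, h2, h3, algHom_C, algebraMap_eq]

lemma sq_re_add_sq_im (p : ℂ) : (p.re : ℂ) ^ 2 + (p.im : ℂ) ^ 2 = ((‖p‖ ^ 2 : ℝ) : ℂ) := by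
  rw [Complex.sq_norm, Complex.normSq_apply]
  push_cast
  ring

lemma cube_re_eq (p : ℂ) :
    (p.re : ℂ) ^ 3 - 3 * (p.re : ℂ) * (p.im : ℂ) ^ 2 = ((p ^ 3).re : ℂ) := by
  simp [pow_succ]
  ring

lemma eval_projPt_imCubeForm (p : ℂ) : eval (projPt p) imCubeForm = ((p ^ 3).im : ℂ) := by
  rw [projPt, eval_imCubeForm]
  simp [pow_succ]
  ring

/-- Invariant forms take equal values at points of one dihedral orbit. -/
lemma eval_invForm_eq_of_cube (d : ℕ) (c : ℕ × ℕ → ℂ) {p q : ℂ}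
    (h : p ^ 3 = q ^ 3 ∨ (starRingEnd ℂ p) ^ 3 = q ^ 3) :
    eval (projPt p) (invForm d c) = eval (projPt q) (invForm d c) := by
  have h1 : ‖p‖ = ‖q‖ := by
    refine (pow_left_inj₀ (norm_nonneg _) (norm_nonneg _) (three_ne_zero)).1 ?_
    rcases h with h | h
    · rw [← norm_pow, h, norm_pow]
    · rw [← norm_pow q, ← h, norm_pow, Complex.norm_conj]
  have h2 : (p ^ 3).re = (q ^ 3).re := by
    rcases h with h | h
    · rw [h]
    · rw [← h, ← map_pow, Complex.conj_re]
  simp only [projPt, eval_invForm, sq_re_add_sq_im, cube_re_eq, h1, h2]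

/-- A nonzero invariant form vanishing at fewer points than the number of coefficients. -/
lemma exists_invForm_ne_zero {ι : Type*} (d : ℕ) (S : Finset ι) (f : ι → ℂ)
    (h : S.card < (invExponents d).card) :
    ∃ c, invForm d c ≠ 0 ∧ ∀ i ∈ S, eval (projPt (f i)) (invForm d c) = 0 := by
  classical
  let g : ι → ℕ × ℕ → ℂ := fun i e =>
    (((f i).re : ℂ) ^ 2 + ((f i).im : ℂ) ^ 2) ^ e.1 *
      (((f i).re : ℂ) ^ 3 - 3 * ((f i).re : ℂ) * ((f i).im : ℂ) ^ 2) ^ e.2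
  let M : Matrix S (invExponents d) ℂ := fun i e => g i e
  have hker : LinearMap.ker M.mulVecLin ≠ ⊥ :=
    LinearMap.ker_ne_bot_of_finrank_lt (by simpa using h)
  obtain ⟨c, hc, hc0⟩ := (Submodule.ne_bot_iff _).1 hker
  refine ⟨fun e => if he : e ∈ invExponents d then c ⟨e, he⟩ else 0, fun h0 => hc0 ?_, ?_⟩
  · ext e
    simpa using coeff_eq_zero_of_invForm_eq_zero h0 e e.2
  · intro i hi
    have := congrFun (LinearMap.mem_ker.1 hc) ⟨i, hi⟩
    rw [Matrix.mulVecLin_apply] at this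
    rw [projPt, eval_invForm, ← Finset.sum_coe_sort]
    simp only [Finset.coe_mem, dite_true, Subtype.coe_eta]
    simpa [M, g, Matrix.mulVec, dotProduct, mul_comm] using this

lemma cubic_of_mem_Bline {n j : ℕ} {z : ℂ} (hz : z ∈ Bline n j) :
    Ppt n j ^ 3 - z * Ppt n j ^ 2 + starRingEnd ℂ z * Ppt n j - 1 = 0 := by
  have hconj : starRingEnd ℂ (Ppt n j) = Complex.exp (-(2 * Real.pi * Complex.I * j / n)) := by
    rw [Ppt, ← Complex.exp_conj]
    simp [neg_div, Complex.conj_ofNat]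
  have hts : Ppt n j * starRingEnd ℂ (Ppt n j) = 1 := by
    rw [hconj, Ppt, ← Complex.exp_add]
    simp
  have hQ : Qpt n j = -(starRingEnd ℂ (Ppt n j)) ^ 2 := by
    rw [hconj, Qpt, ← Complex.exp_nat_mul]
    congr 2
    push_cast
    ring
  unfold Bline at hz
  generalize Ppt n j = t at *
  generalize Qpt n j = q at *
  subst hQ
  split_ifs at hz with h
  · have h2 : z * starRingEnd ℂ t + starRingEnd ℂ z * t = 2 := by
      have h3 := Complex.add_conj (z * starRingEnd ℂ t)
      rw [Set.mem_ofPred_eq] at hz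
      rw [hz] at h3
      simpa using h3
    generalize starRingEnd ℂ t = s at *
    generalize starRingEnd ℂ z = w at *
    have h3 : t ^ 3 = -1 := by
      linear_combination t ^ 2 * h - (t * s + 1) * hts
    linear_combination (w * t - 1) * h3 + (z * t ^ 2) * hts - t ^ 3 * h2
  · have h2 := Complex.conj_eq_iff_im.2 hz
    simp only [map_mul, map_sub, map_neg, map_pow, Complex.conj_conj] at h2
    generalize starRingEnd ℂ t = s at *
    generalize starRingEnd ℂ z = w at *
    have h3 : t ^ 3 + 1 ≠ 0 := by
      intro h3
      refine h ?_
      linear_combination s ^ 2 * h3 - t * (t * s + 1) * hts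
    refine (mul_eq_zero.1 (?_ : (t ^ 3 + 1) * _ = 0)).resolve_left h3
    linear_combination -t ^ 3 * h2 +
      (-w * t * (t * s + 1) + (t ^ 2 * s ^ 2 + t * s + 1) + z * t ^ 2) * hts

lemma sum_and_prod_of_cubic {p q t u v : ℂ} (htu : t ≠ u) (htv : t ≠ v) (huv : u ≠ v)
    (ht : t ^ 3 - p * t ^ 2 + q * t - 1 = 0) (hu : u ^ 3 - p * u ^ 2 + q * u - 1 = 0)
    (hv : v ^ 3 - p * v ^ 2 + q * v - 1 = 0) : p = t + u + v ∧ t * u * v = 1 := by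
  have h1 : t ^ 2 + t * u + u ^ 2 - p * (t + u) + q = 0 := by
    apply mul_left_cancel₀ (sub_ne_zero.2 htu)
    linear_combination ht - hu
  have h2 : t ^ 2 + t * v + v ^ 2 - p * (t + v) + q = 0 := by
    apply mul_left_cancel₀ (sub_ne_zero.2 htv)
    linear_combination ht - hv
  have h3 : p = t + u + v := by
    apply mul_left_cancel₀ (sub_ne_zero.2 huv)
    linear_combination h2 - h1
  refine ⟨h3, ?_⟩
  subst h3
  linear_combination ht - t * h1

/-- The orbit of `z` under the dihedral group meets the chosen representatives. -/
def MeetsOrbitPts (m : ℕ) (ζ z : ℂ) : Prop :=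
  ∃ e ∈ orbitExponents m, z ^ 3 = orbitPt ζ e ^ 3 ∨ (starRingEnd ℂ z) ^ 3 = orbitPt ζ e ^ 3

lemma IsPrimitiveRoot.zpow_eq_of_dvd {ζ : ℂ} {n : ℕ} (hζ : IsPrimitiveRoot ζ n) (hn : n ≠ 0)
    {i j : ℤ} (h : (n : ℤ) ∣ i - j) : ζ ^ i = ζ ^ j := by
  have h0 : ζ ≠ 0 := hζ.ne_zero hn
  have := (hζ.zpow_eq_one_iff_dvd _).2 h
  rw [zpow_sub₀ h0] at this
  exact (div_eq_one_iff_eq (zpow_ne_zero _ h0)).1 this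

lemma meetsOrbitPts_of_eq {m : ℕ} (hm : 0 < m) {ζ : ℂ} (hζ : IsPrimitiveRoot ζ (6 * m))
    {i j k a b r : ℤ} (ha : 0 < a) (hb : 0 < b) (hab : a + b < 2 * m) (hne : a ≠ b)
    (hi : (6 * m : ℤ) ∣ i - (a + 2 * m * r)) (hj : (6 * m : ℤ) ∣ j - (b + 2 * m * r))
    (hk : (6 * m : ℤ) ∣ i + j + k) : MeetsOrbitPts m ζ (ζ ^ i + ζ ^ j + ζ ^ k) := by
  wlog hlt : a < b generalizing a b i j
  · have := this hb ha (by omega) hne.symm hj hi (by rwa [add_comm j i]) (by omega)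
    rwa [add_comm (ζ ^ j)] at this
  lift a to ℕ using ha.le
  lift b to ℕ using hb.le
  refine ⟨(a, b), ?_, Or.inl ?_⟩
  · simp [orbitExponents]
    omega
  have h0 : ζ ≠ 0 := hζ.ne_zero (by omega)
  have hk' : (6 * m : ℤ) ∣ k - (-a - b + 2 * m * r) := by
    have : k - (-a - b + 2 * m * r) =
      (i + j + k) - (i - (a + 2 * m * r)) - (j - (b + 2 * m * r)) - 6 * m * r := by ring
    rw [this]
    exact (((hk.sub hi).sub hj).sub (Dvd.intro _ rfl))
  have hz : ∀ {x y : ℤ}, (6 * m : ℤ) ∣ x - y → ζ ^ x = ζ ^ y := fun h =>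
    hζ.zpow_eq_of_dvd (by omega) (by push_cast; exact h)
  have hc : (ζ ^ (2 * m * r : ℤ)) ^ 3 = 1 := by
    rw [← zpow_natCast, ← zpow_mul, hζ.zpow_eq_one_iff_dvd]
    exact ⟨r, by push_cast; ring⟩
  rw [hz hi, hz hj, hz hk', zpow_add₀ h0, zpow_add₀ h0, zpow_add₀ h0, orbitPt, ← add_mul, ← add_mul,
    mul_pow, hc, mul_one]

lemma meetsOrbitPts_of_emod {m : ℕ} (hm : 0 < m) {ζ : ℂ} (hζ : IsPrimitiveRoot ζ (6 * m))
    {i j k a b c r s t : ℤ} (ha : 0 < a) (hb : 0 < b) (hc : 0 < c) (habc : a + b + c = 2 * m)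
    (hi : i = a + 2 * m * r) (hj : j = b + 2 * m * s) (hk : k = c + 2 * m * t)
    (hij : ¬ (6 * m : ℤ) ∣ i - j) (hik : ¬ (6 * m : ℤ) ∣ i - k) (hjk : ¬ (6 * m : ℤ) ∣ j - k)
    (hsum : (6 * m : ℤ) ∣ i + j + k) : MeetsOrbitPts m ζ (ζ ^ i + ζ ^ j + ζ ^ k) := by
  have key : ∀ {x y : ℤ}, (3 : ℤ) ∣ x → y = 2 * m * x → (6 * m : ℤ) ∣ y := by
    rintro _ y ⟨x, rfl⟩ rfl
    exact ⟨x, by ring⟩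
  have hs : (3 : ℤ) ∣ 1 + r + s + t := by
    obtain ⟨x, hx⟩ := hsum
    refine ⟨x, mul_left_cancel₀ (by positivity : (2 * m : ℤ) ≠ 0) ?_⟩
    subst hi hj hk
    linear_combination hx - habc
  have h3 : (3 : ℤ) ∣ s - r ∨ (3 : ℤ) ∣ t - r ∨ (3 : ℤ) ∣ t - s := by
    clear * - hs
    have hr : r % 3 = 0 ∨ r % 3 = 1 ∨ r % 3 = 2 := by omega
    have hs' : s % 3 = 0 ∨ s % 3 = 1 ∨ s % 3 = 2 := by omega
    rcases hr with hr | hr | hr <;> rcases hs' with hs' | hs' | hs' <;> omega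
  rcases h3 with h | h | h
  · refine meetsOrbitPts_of_eq hm hζ (a := a) (b := b) (r := r) ha hb (by omega) ?_ (by simp [hi])
      (key h (by rw [hj]; ring)) hsum
    rintro rfl
    exact hij ((dvd_sub_comm).1 (key h (by rw [hi, hj]; ring)))
  · have := meetsOrbitPts_of_eq hm hζ (i := i) (j := k) (k := j) (a := a) (b := c) (r := r) ha hc
      (by omega) ?_ (by simp [hi]) (key h (by rw [hk]; ring)) (by rwa [add_right_comm])
    · rwa [add_right_comm]
    · rintro rfl
      exact hik ((dvd_sub_comm).1 (key h (by rw [hi, hk]; ring)))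
  · have := meetsOrbitPts_of_eq hm hζ (i := j) (j := k) (k := i) (a := b) (b := c) (r := s) hb hc
      (by omega) ?_ (by simp [hj]) (key h (by rw [hk]; ring)) (by rwa [add_comm _ i, ← add_assoc])
    · rwa [add_comm _ (ζ ^ i), ← add_assoc] at this
    · rintro rfl
      exact hjk ((dvd_sub_comm).1 (key h (by rw [hj, hk]; ring)))

lemma MeetsOrbitPts.of_conj {m : ℕ} {ζ z : ℂ} (h : MeetsOrbitPts m ζ (starRingEnd ℂ z)) :
    MeetsOrbitPts m ζ z := by
  obtain ⟨e, he, h⟩ := h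
  rw [Complex.conj_conj] at h
  exact ⟨e, he, h.symm⟩

lemma meetsOrbitPts_of_not_dvd {m : ℕ} (hm : 0 < m) {ζ : ℂ} (hζ : IsPrimitiveRoot ζ (6 * m))
    {i j k : ℤ} (hi : ¬ (2 * m : ℤ) ∣ i) (hj : ¬ (2 * m : ℤ) ∣ j) (hk : ¬ (2 * m : ℤ) ∣ k)
    (hij : ¬ (6 * m : ℤ) ∣ i - j) (hik : ¬ (6 * m : ℤ) ∣ i - k) (hjk : ¬ (6 * m : ℤ) ∣ j - k)
    (hsum : (6 * m : ℤ) ∣ i + j + k) : MeetsOrbitPts m ζ (ζ ^ i + ζ ^ j + ζ ^ k) := by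
  have hpos : (0 : ℤ) < 2 * m := by omega
  have bound : ∀ x : ℤ, ¬ (2 * m : ℤ) ∣ x → 0 < x % (2 * m) ∧ x % (2 * m) < 2 * m := fun x hx =>
    ⟨lt_of_le_of_ne (Int.emod_nonneg _ hpos.ne') fun h => hx (Int.dvd_of_emod_eq_zero h.symm),
      Int.emod_lt_of_pos _ hpos⟩
  obtain ⟨a1, a2⟩ := bound i hi
  obtain ⟨b1, b2⟩ := bound j hj
  obtain ⟨c1, c2⟩ := bound k hk
  have ea := (Int.emod_add_mul_ediv i (2 * m)).symm
  have eb := (Int.emod_add_mul_ediv j (2 * m)).symm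
  have ec := (Int.emod_add_mul_ediv k (2 * m)).symm
  generalize i % (2 * m) = a at *
  generalize j % (2 * m) = b at *
  generalize k % (2 * m) = c at *
  generalize i / (2 * m) = r at *
  generalize j / (2 * m) = s at *
  generalize k / (2 * m) = t at *
  have hd : (2 * m : ℤ) ∣ a + b + c := by
    have h1 : (2 * m : ℤ) ∣ i + j + k := dvd_trans ⟨3, by ring⟩ hsum
    have h2 : a + b + c = i + j + k - 2 * m * (r + s + t) := by rw [ea, eb, ec]; ring
    rw [h2]
    exact h1.sub (Dvd.intro _ rfl)
  obtain ⟨x, hx⟩ := hd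
  have hx1 : 0 < x := by
    by_contra! h
    nlinarith
  have hx2 : x < 3 := by
    by_contra! h
    nlinarith
  obtain rfl | rfl : x = 1 ∨ x = 2 := by omega
  · exact meetsOrbitPts_of_emod hm hζ a1 b1 c1 (by omega) ea eb ec hij hik hjk hsum
  · refine MeetsOrbitPts.of_conj ?_
    have hnorm : ‖ζ‖ = 1 := hζ.norm'_eq_one (by omega)
    have hc : starRingEnd ℂ ζ = ζ⁻¹ := (Complex.inv_eq_conj hnorm).symm
    simp only [map_add, map_zpow₀, hc, inv_zpow, ← zpow_neg]
    refine meetsOrbitPts_of_emod hm hζ (a := 2 * m - a) (b := 2 * m - b) (c := 2 * m - c)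
      (r := -r - 1) (s := -s - 1) (t := -t - 1) (by omega) (by omega) (by omega) (by omega)
      (by rw [ea]; ring) (by rw [eb]; ring) (by rw [ec]; ring) ?_ ?_ ?_ ?_
    · rwa [neg_sub_neg, dvd_sub_comm]
    · rwa [neg_sub_neg, dvd_sub_comm]
    · rwa [neg_sub_neg, dvd_sub_comm]
    · rw [← neg_add, ← neg_add]
      exact hsum.neg_right

/-- A sum of three unimodular numbers with product `1`, one of them a cube root of unity, lies on
a mirror. -/
lemma cube_im_eq_zero {t u v : ℂ} (hu : ‖u‖ = 1) (hv : ‖v‖ = 1)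
    (h : t * u * v = 1) (ht3 : t ^ 3 = 1) : ((t + u + v) ^ 3).im = 0 := by
  have ht : ‖t‖ = 1 := by
    have := congrArg norm h
    simpa [hu, hv] using this
  rw [← Complex.conj_eq_iff_im]
  have ht' := Complex.inv_eq_conj ht
  have hu' := Complex.inv_eq_conj hu
  have hv' := Complex.inv_eq_conj hv
  have htn : t ≠ 0 := by rintro rfl; simp at ht
  have hun : u ≠ 0 := by rintro rfl; simp at hu
  have hvn : v ≠ 0 := by rintro rfl; simp at hv
  have hti : t⁻¹ = t ^ 2 := by field_simp; exact ht3.symm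
  have hui : u⁻¹ = t * v := by field_simp; linear_combination -h
  have hvi : v⁻¹ = t * u := by field_simp; linear_combination -h
  rw [map_pow, map_add, map_add, ← ht', ← hu', ← hv', hti, hui, hvi]
  have : t ^ 2 + t * v + t * u = t * (t + u + v) := by ring
  rw [this, mul_pow, ht3, one_mul]

lemma meetsOrbitPts_of_mem_triplePts {m : ℕ} (hm : 0 < m) {p : ℂ} (hp : p ∈ TriplePts (6 * m))
    (him : (p ^ 3).im ≠ 0) :
    MeetsOrbitPts m (Complex.exp (2 * Real.pi * Complex.I / (6 * m : ℕ))) p := by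
  have hn : 6 * m ≠ 0 := by omega
  have hζ := Complex.isPrimitiveRoot_exp (6 * m) hn
  have hP : ∀ j : ℕ, Ppt (6 * m) j =
      Complex.exp (2 * Real.pi * Complex.I / (6 * m : ℕ)) ^ (j : ℤ) := by
    intro j
    rw [zpow_natCast, ← Complex.exp_nat_mul, Ppt]
    congr 1
    ring
  generalize Complex.exp (2 * Real.pi * Complex.I / (6 * m : ℕ)) = ζ at *
  have hnorm : ‖ζ‖ = 1 := hζ.norm'_eq_one hn
  have h0 : ζ ≠ 0 := hζ.ne_zero hn
  have hfin : ({j : ℕ | j < 6 * m ∧ p ∈ Bline (6 * m) j} : Set ℕ).Finite :=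
    (Set.finite_lt_nat (6 * m)).subset fun j hj => hj.1
  obtain ⟨i, j, k, ⟨hi, hpi⟩, ⟨hj, hpj⟩, ⟨hk, hpk⟩, hij, hik, hjk⟩ :=
    (Set.two_lt_ncard_iff hfin).1 hp
  have inj : ∀ {x y : ℕ}, x < 6 * m → y < 6 * m → x ≠ y → ¬ (6 * m : ℤ) ∣ (x : ℤ) - y := by
    intro x y hx hy hxy hd
    have := Int.eq_zero_of_abs_lt_dvd hd (by rw [abs_lt]; omega)
    omega
  have hne : ∀ {x y : ℕ}, x < 6 * m → y < 6 * m → x ≠ y → ζ ^ (x : ℤ) ≠ ζ ^ (y : ℤ) := by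
    intro x y hx hy hxy h
    rw [zpow_natCast, zpow_natCast] at h
    exact hxy (hζ.pow_inj hx hy h)
  have hcube : ∀ x : ℤ, (2 * m : ℤ) ∣ x → (ζ ^ x) ^ 3 = 1 := by
    rintro _ ⟨x, rfl⟩
    rw [← zpow_natCast, ← zpow_mul, hζ.zpow_eq_one_iff_dvd]
    exact ⟨x, by push_cast; ring⟩
  have hz : ∀ x : ℤ, ‖ζ ^ x‖ = 1 := fun x => by simp [hnorm]
  have ci := cubic_of_mem_Bline hpi
  have cj := cubic_of_mem_Bline hpj
  have ck := cubic_of_mem_Bline hpk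
  rw [hP] at ci cj ck
  obtain ⟨hs, hprod⟩ :=
    sum_and_prod_of_cubic (hne hi hj hij) (hne hi hk hik) (hne hj hk hjk) ci cj ck
  rw [hs] at him ⊢
  refine meetsOrbitPts_of_not_dvd hm hζ (fun hd => him ?_) (fun hd => him ?_) (fun hd => him ?_)
    (inj hi hj hij) (inj hi hk hik) (inj hj hk hjk) ?_
  · exact cube_im_eq_zero (hz _) (hz _) hprod (hcube _ hd)
  · rw [add_comm (ζ ^ (i : ℤ))]
    exact cube_im_eq_zero (hz _) (hz _) (by rw [mul_comm (ζ ^ (j : ℤ)), hprod]) (hcube _ hd)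
  · rw [add_comm, ← add_assoc]
    exact cube_im_eq_zero (hz _) (hz _) (by rw [mul_assoc, mul_comm, hprod]) (hcube _ hd)
  · rw [← zpow_add₀ h0, ← zpow_add₀ h0, hζ.zpow_eq_one_iff_dvd] at hprod
    exact_mod_cast hprod

/-- For `6 ∣ n`, `n ≥ 12`, and `d` the least natural number with
`⌊(d² + 6d)/12⌋ ≥ (n-6)²/36`, there is a nonzero homogeneous skew-invariant
form of degree `d + 3` vanishing at every triple point. -/
theorem boroczky_skew_invariant_form (n : ℕ) (hn : 12 ≤ n) (hdvd : 6 ∣ n)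
    (d : ℕ) (hd : (n - 6) ^ 2 / 36 ≤ (d ^ 2 + 6 * d) / 12)
    (hdmin : ∀ d' : ℕ, d' < d → ¬ ((n - 6) ^ 2 / 36 ≤ (d' ^ 2 + 6 * d') / 12)) :
    ∃ G : MvPolynomial (Fin 3) ℂ, G ≠ 0 ∧ G.IsHomogeneous (d + 3) ∧
      (∀ p ∈ TriplePts n, eval (projPt p) G = 0) ∧
      rotSub G = G ∧ reflSub G = -G := by
  obtain ⟨m, rfl⟩ := hdvd
  have hm : 0 < m := by omega
  have hcard : (orbitExponents m).card < (invExponents d).card := by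
    have h1 : (6 * m - 6) ^ 2 / 36 = (m - 1) ^ 2 := by
      have : (6 * m - 6) ^ 2 = 36 * (m - 1) ^ 2 := by
        rw [show 6 * m - 6 = 6 * (m - 1) by omega]
        ring
      rw [this, Nat.mul_div_cancel_left _ (by norm_num)]
    have := card_orbitExponents m
    have := card_invExponents d
    omega
  obtain ⟨c, hc, hvan⟩ := exists_invForm_ne_zero d (orbitExponents m)
    (orbitPt (Complex.exp (2 * Real.pi * Complex.I / (6 * m : ℕ)))) hcard
  refine ⟨invForm d c * imCubeForm, mul_ne_zero hc imCubeForm_ne_zero,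
    (isHomogeneous_invForm d c).mul isHomogeneous_imCubeForm, fun p hp => ?_, ?_, ?_⟩
  · rw [map_mul, eval_projPt_imCubeForm]
    by_cases him : (p ^ 3).im = 0
    · simp [him]
    · obtain ⟨e, he, h⟩ := meetsOrbitPts_of_mem_triplePts hm hp him
      rw [eval_invForm_eq_of_cube d c h, hvan e he, zero_mul]
  · rw [map_mul, rotSub_invForm, rotSub_imCubeForm]
  · rw [map_mul, reflSub_invForm, reflSub_imCubeForm, mul_neg]
end

section
/- Let n ≥ 12 be an integer divisible by 6, and let d be the least nonnegative integer such that ⌊(d² + 6d)/12⌋ ≥ (n−6)²/36. Then: (i) every nonzero homogeneous polynomial F ∈ ℂ[x,y,z] with F(a,b,1) = 0 for every (a,b) ∈ ℬ_n satisfies 3·deg(F) ≥ n; and (ii) there exists a nonzero homogeneous polynomial F ∈ ℂ[x,y,z] of degree at most d + 3 with F(a,b,1) = 0 for every (a,b) ∈ ℬ_n. Hence the minimal degree α(I_n) of a nonzero homogeneous form vanishing at all points of ℬ_n satisfies n/3 ≤ α(I_n) ≤ d + 3. -/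
open Complex

open MvPolynomial

/-- The point of `ℂ³` with `x + iy = z`, `x - iy = w` and last coordinate `t`. -/
noncomputable def conjPt (z w t : ℂ) : Fin 3 → ℂ := ![(z + w) / 2, (z - w) / (2 * I), t]

lemma projPt_eq_conjPt (p : ℂ) : projPt p = conjPt p ((starRingEnd ℂ) p) 1 := by
  have h1 : (p.re : ℂ) = (p + (starRingEnd ℂ) p) / 2 := by
    rw [Complex.add_conj]; push_cast; ring
  have h2 : (p.im : ℂ) = (p - (starRingEnd ℂ) p) / (2 * I) := by
    rw [Complex.sub_conj]; push_cast; field_simp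
  rw [projPt, conjPt, h1, h2]

lemma MvPolynomial.IsHomogeneous.eval_mul {σ R : Type*} [Fintype σ] [CommRing R]
    {F : MvPolynomial σ R} {e : ℕ} (hF : F.IsHomogeneous e) (c : R) (x : σ → R) :
    eval (fun i => c * x i) F = c ^ e * eval x F := by
  rw [eval_eq', eval_eq', Finset.mul_sum]
  refine Finset.sum_congr rfl fun d hd => ?_
  have hdeg : ∑ i, d i = e := by
    have := hF.degree_eq_sum_deg_support hd
    rw [this]
    exact (Finset.sum_subset (Finset.subset_univ _) (by simp)).symm
  simp_rw [mul_pow]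
  rw [Finset.prod_mul_distrib, Finset.prod_pow_eq_pow_sum, hdeg]
  ring

lemma eq_zero_of_eval_conjPt_eq_zero {F : MvPolynomial (Fin 3) ℂ} {e : ℕ}
    (hF : F.IsHomogeneous e) (h : ∀ z w, eval (conjPt z w 1) F = 0) : F = 0 := by
  have hX : X 2 * F = 0 := by
    refine MvPolynomial.funext fun x => ?_
    rw [map_mul, eval_X, map_zero]
    by_cases hx : x 2 = 0
    · simp [hx]
    have := hF.eval_mul (x 2) (conjPt ((x 0 + I * x 1) / x 2) ((x 0 - I * x 1) / x 2) 1)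
    rw [h, mul_zero] at this
    have hx' : x = fun i => x 2 * conjPt ((x 0 + I * x 1) / x 2) ((x 0 - I * x 1) / x 2) 1 i := by
      funext i
      fin_cases i <;> simp [conjPt] <;> field_simp <;> ring
    rw [← hx'] at this
    simp [this]
  exact (mul_eq_zero.mp hX).resolve_left (X_ne_zero 2)

/-- Every `(z, w)` consists of the elementary symmetric functions of three numbers
with product one. -/
lemma exists_roots_prod_one (z w : ℂ) :
    ∃ u v : ℂ, u ≠ 0 ∧ v ≠ 0 ∧ u * v * z = u ^ 2 * v + u * v ^ 2 + 1 ∧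
      u * v * w = u ^ 2 * v ^ 2 + u + v := by
  obtain ⟨u, hu⟩ := IsAlgClosed.exists_root
    (Polynomial.X ^ 3 - Polynomial.C z * Polynomial.X ^ 2 + Polynomial.C w * Polynomial.X - 1) (by
      have : (Polynomial.X ^ 3 - Polynomial.C z * Polynomial.X ^ 2 + Polynomial.C w * Polynomial.X
        - 1 : Polynomial ℂ).degree = 3 := by compute_degree!
      rw [this]; norm_num)
  simp only [Polynomial.IsRoot, Polynomial.eval_sub, Polynomial.eval_add, Polynomial.eval_mul,
    Polynomial.eval_pow, Polynomial.eval_X, Polynomial.eval_C, Polynomial.eval_one] at hu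
  have hu0 : u ≠ 0 := by rintro rfl; simp at hu
  obtain ⟨v, hv⟩ := IsAlgClosed.exists_root
    (Polynomial.X ^ 2 - Polynomial.C (z - u) * Polynomial.X + Polynomial.C (1 / u)) (by
      have : (Polynomial.X ^ 2 - Polynomial.C (z - u) * Polynomial.X
        + Polynomial.C (1 / u) : Polynomial ℂ).degree = 2 := by compute_degree!
      rw [this]; norm_num)
  simp only [Polynomial.IsRoot, Polynomial.eval_sub, Polynomial.eval_add, Polynomial.eval_mul,
    Polynomial.eval_pow, Polynomial.eval_X, Polynomial.eval_C] at hv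
  have hv' : u * v ^ 2 - (z - u) * u * v + 1 = 0 := by
    field_simp at hv; linear_combination hv
  have hv0 : v ≠ 0 := by rintro rfl; simp at hv'
  refine ⟨u, v, hu0, hv0, by linear_combination -hv', ?_⟩
  linear_combination v * hu - u * hv'

/-- The point `conjPt z w 1` attached to the numbers `u, v, (uv)⁻¹`, scaled by `uv`. -/
noncomputable def tripleCurve (u v : ℂ) : Fin 3 → ℂ :=
  conjPt (u ^ 2 * v + u * v ^ 2 + 1) (u ^ 2 * v ^ 2 + u + v) (u * v)

lemma tripleCurve_comm (u v : ℂ) : tripleCurve u v = tripleCurve v u := by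
  unfold tripleCurve; congr 1 <;> ring

lemma tripleCurve_eq_smul {u v z w : ℂ} (hz : u * v * z = u ^ 2 * v + u * v ^ 2 + 1)
    (hw : u * v * w = u ^ 2 * v ^ 2 + u + v) :
    tripleCurve u v = fun i => u * v * conjPt z w 1 i := by
  rw [tripleCurve, ← hz, ← hw]
  funext i
  fin_cases i <;> simp [conjPt] <;> ring

lemma eq_zero_of_eval_tripleCurve_eq_zero {F : MvPolynomial (Fin 3) ℂ} {e : ℕ}
    (hF : F.IsHomogeneous e) (h : ∀ u v, eval (tripleCurve u v) F = 0) : F = 0 := by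
  refine eq_zero_of_eval_conjPt_eq_zero hF fun z w => ?_
  obtain ⟨u, v, hu, hv, hz, hw⟩ := exists_roots_prod_one z w
  have := h u v
  rw [tripleCurve_eq_smul hz hw, hF.eval_mul] at this
  exact (mul_eq_zero.mp this).resolve_left (pow_ne_zero _ (mul_ne_zero hu hv))

/-- For fixed `v`, a form of degree `e` restricted to `tripleCurve · v` is a polynomial of degree
at most `2e`. -/
lemma exists_polynomial_tripleCurve {F : MvPolynomial (Fin 3) ℂ} {e : ℕ}
    (hF : F.IsHomogeneous e) (v : ℂ) :
    ∃ p : Polynomial ℂ, p.natDegree ≤ e * 2 ∧ ∀ u, p.eval u = eval (tripleCurve u v) F := by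
  let Z : Polynomial ℂ := Polynomial.C v * Polynomial.X ^ 2 + Polynomial.C (v ^ 2) * Polynomial.X
    + 1
  let W : Polynomial ℂ := Polynomial.C (v ^ 2) * Polynomial.X ^ 2 + Polynomial.X + Polynomial.C v
  let g : Fin 3 → Polynomial ℂ := ![Polynomial.C (1 / 2) * (Z + W),
    Polynomial.C (1 / (2 * I)) * (Z - W), Polynomial.C v * Polynomial.X]
  refine ⟨aeval g F, aeval_natDegree_le F hF.totalDegree_le g ?_, fun u => ?_⟩
  · intro i
    fin_cases i
    · change (Polynomial.C (1 / 2) * (Z + W)).natDegree ≤ 2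
      unfold Z W
      compute_degree
    · change (Polynomial.C (1 / (2 * I)) * (Z - W)).natDegree ≤ 2
      unfold Z W
      compute_degree
    · change (Polynomial.C v * Polynomial.X).natDegree ≤ 2
      compute_degree
      all_goals norm_num
  · rw [aeval_def, polynomial_eval_eval₂]
    have h1 : (Polynomial.evalRingHom u).comp (algebraMap ℂ (Polynomial ℂ)) = RingHom.id ℂ := by
      ext; simp
    have h2 : (fun s => Polynomial.eval u (g s)) = tripleCurve u v := by
      funext i
      fin_cases i
      · simp [g, Z, W, tripleCurve, conjPt]; ring
      · simp [g, Z, W, tripleCurve, conjPt]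
        field_simp
        linear_combination (-1 + v - v * u ^ 2 - v ^ 2 * u + v ^ 2 * u ^ 2 + u) * I_sq
      · simp [g, tripleCurve, conjPt]; ring
    rw [h1, h2, eval₂_id]

lemma Polynomial.eq_zero_of_forall_pow_eq_one {n : ℕ} (hn : n ≠ 0) {p : Polynomial ℂ}
    (hp : p.natDegree < n) (h : ∀ u : ℂ, u ^ n = 1 → p.eval u = 0) : p = 0 := by
  refine Polynomial.eq_zero_of_natDegree_lt_card_of_eval_eq_zero' p
    (Polynomial.nthRootsFinset n (1 : ℂ)) (fun u hu => h u ?_) ?_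
  · exact (Polynomial.mem_nthRootsFinset (Nat.pos_of_ne_zero hn) _).mp hu
  · rwa [(Complex.isPrimitiveRoot_exp n hn).card_nthRootsFinset]

lemma eq_zero_of_eval_tripleCurve_roots {F : MvPolynomial (Fin 3) ℂ} {e n : ℕ}
    (hF : F.IsHomogeneous e) (hn : e * 2 + 4 < n)
    (h : ∀ u v : ℂ, u ^ n = 1 → v ^ n = 1 → u ≠ v → u ^ 2 * v ≠ 1 → u * v ^ 2 ≠ 1 →
      eval (tripleCurve u v) F = 0) : F = 0 := by
  have key : ∀ v : ℂ, v ^ n = 1 → ∀ u, eval (tripleCurve u v) F = 0 := by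
    intro v hv u
    obtain ⟨p, hp, hpe⟩ := exists_polynomial_tripleCurve hF v
    rw [← hpe]
    let q : Polynomial ℂ := (Polynomial.X - Polynomial.C v) *
      ((Polynomial.C v * Polynomial.X ^ 2 - 1) * (Polynomial.C (v ^ 2) * Polynomial.X - 1))
    have hq : q.natDegree ≤ 4 := by unfold q; compute_degree
    have hq0 : q ≠ 0 := by
      refine mul_ne_zero (Polynomial.X_sub_C_ne_zero v) (mul_ne_zero ?_ ?_) <;>
      · intro h0
        have := congrArg (Polynomial.eval 0) h0
        simp at this
    have hpq : p * q = 0 := by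
      refine Polynomial.eq_zero_of_forall_pow_eq_one (n := n) (by omega) ?_ fun x hx => ?_
      · exact Polynomial.natDegree_mul_le.trans_lt (by omega)
      · rw [Polynomial.eval_mul, hpe]
        have hqe : q.eval x = (x - v) * ((v * x ^ 2 - 1) * (v ^ 2 * x - 1)) := by simp [q]
        rw [hqe]
        by_cases h1 : x = v
        · simp [h1]
        by_cases h2 : x ^ 2 * v = 1
        · rw [mul_comm] at h2; simp [h2]
        by_cases h3 : x * v ^ 2 = 1
        · rw [mul_comm] at h3; simp [h3]
        rw [h x v hx hv h1 h2 h3, zero_mul]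
    rw [(mul_eq_zero.mp hpq).resolve_right hq0, Polynomial.eval_zero]
  refine eq_zero_of_eval_tripleCurve_eq_zero hF fun u v => ?_
  obtain ⟨p, hp, hpe⟩ := exists_polynomial_tripleCurve hF v
  have hp0 : p = 0 := Polynomial.eq_zero_of_forall_pow_eq_one (n := n) (by omega) (by omega)
    fun x hx => by rw [hpe, tripleCurve_comm]; exact key x hx v
  rw [← hpe, hp0, Polynomial.eval_zero]

lemma Ppt_eq_pow (n j : ℕ) : Ppt n j = Complex.exp (2 * Real.pi * I / n) ^ j := by
  rw [Ppt, ← Complex.exp_nat_mul]; congr 1; ring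

lemma Qpt_eq (n j : ℕ) : Qpt n j = -(Ppt n j)⁻¹ ^ 2 := by
  rw [Qpt, Ppt, ← Complex.exp_neg, ← Complex.exp_nat_mul]; congr 2; push_cast; ring

lemma conj_eq_inv_of_pow_eq_one {n : ℕ} (hn : n ≠ 0) {u : ℂ} (hu : u ^ n = 1) :
    (starRingEnd ℂ) u = u⁻¹ :=
  (Complex.inv_eq_conj (Complex.norm_eq_one_of_pow_eq_one hu hn)).symm

lemma root_pow_eq_one {n : ℕ} (hn : n ≠ 0) : Complex.exp (2 * Real.pi * I / n) ^ n = 1 :=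
  (Complex.isPrimitiveRoot_exp n hn).pow_eq_one

lemma mem_Bline_iff {n : ℕ} (hn : n ≠ 0) (j : ℕ) (z : ℂ) :
    z ∈ Bline n j ↔ Ppt n j ^ 3 - z * Ppt n j ^ 2 + (starRingEnd ℂ) z * Ppt n j - 1 = 0 := by
  have hu : Ppt n j ^ n = 1 := by
    rw [Ppt_eq_pow, pow_right_comm, root_pow_eq_one hn, one_pow]
  have hc := conj_eq_inv_of_pow_eq_one hn hu
  rw [Bline, Qpt_eq]
  generalize Ppt n j = u at *
  have hu0 : u ≠ 0 := by rintro rfl; rw [zero_pow hn] at hu; simp at hu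
  generalize hw : (starRingEnd ℂ) z = w
  split_ifs with h
  · have h3 : u ^ 3 = -1 := by field_simp at h; linear_combination h
    have e1 : z ∈ {z : ℂ | (z * (starRingEnd ℂ) u).re = 1} ↔
        z * u⁻¹ + w * u = 2 := by
      have hre : ((z * (starRingEnd ℂ) u).re : ℂ) = (z * u⁻¹ + w * u) / 2 := by
        rw [Complex.re_eq_add_conj, map_mul, Complex.conj_conj, hc, hw]
      rw [Set.mem_ofPred_eq, ← Complex.ofReal_inj, hre, Complex.ofReal_one,
        div_eq_one_iff_eq two_ne_zero]
    have e2 : u * (z * u⁻¹ + w * u - 2) = u * (u ^ 3 - z * u ^ 2 + w * u - 1) := by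
      field_simp
      linear_combination (-u + z) * h3
    rw [e1, ← sub_eq_zero, mul_left_cancel₀ hu0 e2]
  · have h3 : u ^ 3 + 1 ≠ 0 := by
      intro h3; apply h; field_simp; linear_combination h3
    have e1 : z ∈ {z : ℂ | ((z - u) * (starRingEnd ℂ) (-u⁻¹ ^ 2 - u)).im = 0} ↔
        (z - u) * (-u ^ 2 - u⁻¹) = (w - u⁻¹) * (-u⁻¹ ^ 2 - u) := by
      rw [Set.mem_ofPred_eq, ← Complex.conj_eq_iff_im, eq_comm]
      simp only [map_mul, map_sub, map_neg, map_pow, map_inv₀, hc, hw, inv_inv]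
    rw [e1]
    have e2 : u ^ 3 * ((z - u) * (-u ^ 2 - u⁻¹) - (w - u⁻¹) * (-u⁻¹ ^ 2 - u)) =
      (u ^ 3 + 1) * (u ^ 3 - z * u ^ 2 + w * u - 1) := by
      field_simp; ring
    rw [← sub_eq_zero, ← mul_right_inj' (pow_ne_zero 3 hu0), e2, mul_zero, mul_eq_zero,
      or_iff_right h3]

/-- The sum of three integral powers of `ζ`. -/
noncomputable def zpowSum (ζ : ℂ) (a b c : ℤ) : ℂ := ζ ^ a + ζ ^ b + ζ ^ c

lemma zpowSum_add {ζ : ℂ} (h0 : ζ ≠ 0) (a b c k : ℤ) :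
    zpowSum ζ (k + a) (k + b) (k + c) = ζ ^ k * zpowSum ζ a b c := by
  simp only [zpowSum, zpow_add₀ h0]; ring

/-- Either `z ^ 3 = w ^ 3`, or `z * w` and `z ^ 3 + w ^ 3` agree with the values at one of the
representatives `zpowSum ζ (-(p + s)) (-s) (p + 2 * s)`. -/
def IsMirrorOrRep (ζ : ℂ) (m : ℕ) (z w : ℂ) : Prop :=
  z ^ 3 = w ^ 3 ∨ ∃ p s : ℤ, 1 ≤ p ∧ 1 ≤ s ∧ p + 2 * s < 2 * m ∧
    z * w = zpowSum ζ (-(p + s)) (-s) (p + 2 * s) * zpowSum ζ (p + s) s (-(p + 2 * s)) ∧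
    z ^ 3 + w ^ 3 = zpowSum ζ (-(p + s)) (-s) (p + 2 * s) ^ 3 +
      zpowSum ζ (p + s) s (-(p + 2 * s)) ^ 3

lemma IsMirrorOrRep.symm {ζ : ℂ} {m : ℕ} {z w : ℂ} (h : IsMirrorOrRep ζ m z w) :
    IsMirrorOrRep ζ m w z := by
  rcases h with h | ⟨p, s, hp, hs, hps, h1, h2⟩
  · exact Or.inl h.symm
  · exact Or.inr ⟨p, s, hp, hs, hps, by rw [mul_comm, h1], by rw [add_comm, h2]⟩

section Gaps

variable {ζ : ℂ} {m : ℕ}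

lemma zpow_two_mul_pow_three (hζ : ζ ^ (6 * m) = 1) (k : ℤ) :
    (ζ ^ (2 * (m * k))) ^ 3 = 1 := by
  rw [← zpow_natCast, ← zpow_mul, show 2 * ((m : ℤ) * k) * (3 : ℕ) = ((6 * m : ℕ) : ℤ) * k by
    push_cast; ring, zpow_mul, zpow_natCast, hζ, one_zpow]

lemma zpow_add_period (h0 : ζ ≠ 0) (hζ : ζ ^ (6 * m) = 1) (a k : ℤ) :
    ζ ^ (a + 6 * m * k) = ζ ^ a := by
  rw [zpow_add₀ h0, zpow_mul]
  have : ζ ^ (6 * (m : ℤ)) = 1 := by exact_mod_cast hζ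
  rw [this, one_zpow, mul_one]

lemma isMirrorOrRep_of_gaps_lt (h0 : ζ ≠ 0) (hζ : ζ ^ (6 * m) = 1) {a b c k : ℤ}
    (hab : a < b) (hpq : b - a < c - b) (hqr : c - b < a + 6 * m - c)
    (hk : a + b + c = 6 * m * k) :
    IsMirrorOrRep ζ m (zpowSum ζ a b c) (zpowSum ζ (-a) (-b) (-c)) := by
  have hy := zpow_two_mul_pow_three hζ k
  rw [mul_assoc] at hk
  generalize (m : ℤ) * k = K at hk hy
  refine Or.inr ⟨b - a, 2 * K - b, by omega, by omega, by omega, ?_⟩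
  have hZ := zpowSum_add h0 (-(b - a + (2 * K - b))) (-(2 * K - b)) (b - a + 2 * (2 * K - b))
    (2 * K)
  have hW := zpowSum_add h0 (b - a + (2 * K - b)) (2 * K - b) (-(b - a + 2 * (2 * K - b)))
    (-(2 * K))
  rw [show 2 * K + -(b - a + (2 * K - b)) = a by ring, show 2 * K + -(2 * K - b) = b by ring,
    show 2 * K + (b - a + 2 * (2 * K - b)) = c by linarith] at hZ
  rw [show -(2 * K) + (b - a + (2 * K - b)) = -a by ring,
    show -(2 * K) + (2 * K - b) = -b by ring,
    show -(2 * K) + -(b - a + 2 * (2 * K - b)) = -c by linarith, zpow_neg] at hW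
  have hy0 : ζ ^ (2 * K) ≠ 0 := zpow_ne_zero _ h0
  rw [hZ, hW]
  constructor
  · field_simp
  · rw [mul_pow, mul_pow, inv_pow, hy]; ring

lemma isMirrorOrRep_of_gap_eq (h0 : ζ ≠ 0) (hζ : ζ ^ (6 * m) = 1) {a b c k : ℤ}
    (hpq : b - a = c - b) (hk : a + b + c = 6 * m * k) :
    IsMirrorOrRep ζ m (zpowSum ζ a b c) (zpowSum ζ (-a) (-b) (-c)) := by
  have hy := zpow_two_mul_pow_three hζ k
  rw [mul_assoc] at hk
  generalize (m : ℤ) * k = K at hk hy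
  have hZ := zpowSum_add h0 (a - b) 0 (b - a) (2 * K)
  have hW := zpowSum_add h0 (b - a) 0 (a - b) (-(2 * K))
  rw [show 2 * K + (a - b) = a by linarith, show 2 * K + 0 = b by linarith,
    show 2 * K + (b - a) = c by linarith] at hZ
  rw [show -(2 * K) + (b - a) = -a by linarith, show -(2 * K) + 0 = -b by linarith,
    show -(2 * K) + (a - b) = -c by linarith, zpow_neg] at hW
  left
  rw [hZ, hW, mul_pow, mul_pow, inv_pow, hy, zpowSum, zpowSum]
  ring

lemma zpowSum_rotate (h0 : ζ ≠ 0) (hζ : ζ ^ (6 * m) = 1) (a b c : ℤ) :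
    zpowSum ζ b c (a + 6 * m) = zpowSum ζ a b c ∧
      zpowSum ζ (-b) (-c) (-(a + 6 * m)) = zpowSum ζ (-a) (-b) (-c) := by
  have h1 := zpow_add_period h0 hζ a 1
  have h2 := zpow_add_period h0 hζ (-a) (-1)
  rw [mul_one] at h1
  rw [show -a + 6 * (m : ℤ) * -1 = -(a + 6 * m) by ring] at h2
  constructor
  · rw [zpowSum, zpowSum, h1]; ring
  · rw [zpowSum, zpowSum, h2]; ring

lemma isMirrorOrRep_rotate (h0 : ζ ≠ 0) (hζ : ζ ^ (6 * m) = 1) {a b c : ℤ}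
    (h : IsMirrorOrRep ζ m (zpowSum ζ b c (a + 6 * m)) (zpowSum ζ (-b) (-c) (-(a + 6 * m)))) :
    IsMirrorOrRep ζ m (zpowSum ζ a b c) (zpowSum ζ (-a) (-b) (-c)) := by
  rwa [(zpowSum_rotate h0 hζ a b c).1, (zpowSum_rotate h0 hζ a b c).2] at h

lemma isMirrorOrRep_of_gap_le (h0 : ζ ≠ 0) (hζ : ζ ^ (6 * m) = 1) {a b c k : ℤ}
    (hab : a < b) (hpq : b - a ≤ c - b) (hpr : b - a ≤ a + 6 * m - c)
    (hk : a + b + c = 6 * m * k) :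
    IsMirrorOrRep ζ m (zpowSum ζ a b c) (zpowSum ζ (-a) (-b) (-c)) := by
  rcases hpq.eq_or_lt with hpq | hpq
  · exact isMirrorOrRep_of_gap_eq h0 hζ hpq hk
  rcases hpr.eq_or_lt with hpr | hpr
  · refine isMirrorOrRep_rotate h0 hζ (isMirrorOrRep_rotate h0 hζ
      (isMirrorOrRep_of_gap_eq h0 hζ (k := k + 2) (by linarith) (by linarith)))
  rcases lt_trichotomy (c - b) (a + 6 * m - c) with h | h | h
  · exact isMirrorOrRep_of_gaps_lt h0 hζ hab hpq h hk
  · exact isMirrorOrRep_rotate h0 hζ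
      (isMirrorOrRep_of_gap_eq h0 hζ (k := k + 1) (by linarith) (by linarith))
  · have := isMirrorOrRep_of_gaps_lt h0 hζ (a := -b) (b := -a) (c := -c + 6 * m) (k := -k + 1)
      (by linarith) (by linarith) (by linarith) (by linarith)
    obtain ⟨h1, h2⟩ := zpowSum_rotate h0 hζ (-c) (-b) (-a)
    rw [h1, h2, neg_neg, neg_neg, neg_neg] at this
    simpa only [zpowSum, add_comm, add_left_comm, add_assoc] using this.symm

lemma isMirrorOrRep_of_sum_eq (h0 : ζ ≠ 0) (hζ : ζ ^ (6 * m) = 1) {a b c k : ℤ}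
    (hab : a < b) (hbc : b < c) (hca : c < a + 6 * m) (hk : a + b + c = 6 * m * k) :
    IsMirrorOrRep ζ m (zpowSum ζ a b c) (zpowSum ζ (-a) (-b) (-c)) := by
  have key : (b - a ≤ c - b ∧ b - a ≤ a + 6 * m - c) ∨ (c - b ≤ a + 6 * m - c ∧ c - b ≤ b - a) ∨
    (a + 6 * m - c ≤ b - a ∧ a + 6 * m - c ≤ c - b) := by omega
  rcases key with h | h | h
  · exact isMirrorOrRep_of_gap_le h0 hζ hab h.1 h.2 hk
  · exact isMirrorOrRep_rotate h0 hζ (isMirrorOrRep_of_gap_le h0 hζ (k := k + 1) hbc h.1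
      (by linarith) (by linarith))
  · exact isMirrorOrRep_rotate h0 hζ (isMirrorOrRep_rotate h0 hζ
      (isMirrorOrRep_of_gap_le h0 hζ (k := k + 2) hca (by linarith) (by linarith) (by linarith)))

end Gaps

lemma exists_triplePt_of_pow_eq_one {n : ℕ} (hn : n ≠ 0) {u v : ℂ} (hu : u ^ n = 1)
    (hv : v ^ n = 1) (huv : u ≠ v) (h1 : u ^ 2 * v ≠ 1) (h2 : u * v ^ 2 ≠ 1) :
    ∃ p ∈ TriplePts n, tripleCurve u v = fun i => u * v * projPt p i := by
  have hu0 : u ≠ 0 := by rintro rfl; simp [hn] at hu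
  have hv0 : v ≠ 0 := by rintro rfl; simp [hn] at hv
  have hconj : (starRingEnd ℂ) (u + v + (u * v)⁻¹) = u⁻¹ + v⁻¹ + u * v := by
    simp only [map_add, map_mul, map_inv₀, conj_eq_inv_of_pow_eq_one hn hu,
      conj_eq_inv_of_pow_eq_one hn hv]
    field_simp
  refine ⟨u + v + (u * v)⁻¹, ?_, ?_⟩
  · have hx : ((u * v)⁻¹) ^ n = 1 := by rw [inv_pow, mul_pow, hu, hv]; simp
    have hprim := Complex.isPrimitiveRoot_exp n hn
    have : NeZero n := ⟨hn⟩
    obtain ⟨i, hi, hiu⟩ := hprim.eq_pow_of_pow_eq_one hu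
    obtain ⟨j, hj, hjv⟩ := hprim.eq_pow_of_pow_eq_one hv
    obtain ⟨k, hk, hkx⟩ := hprim.eq_pow_of_pow_eq_one hx
    rw [← Ppt_eq_pow] at hiu hjv hkx
    rw [TriplePts, Set.mem_ofPred_eq, Nat.succ_le_iff, Set.two_lt_ncard_iff
      ((Set.finite_Iio n).subset fun a ha => ha.1)]
    refine ⟨i, j, k, ⟨hi, ?_⟩, ⟨hj, ?_⟩, ⟨hk, ?_⟩, ?_, ?_, ?_⟩
    · rw [mem_Bline_iff hn, hiu, hconj]; field_simp; ring
    · rw [mem_Bline_iff hn, hjv, hconj]; field_simp; ring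
    · rw [mem_Bline_iff hn, hkx, hconj]; field_simp; ring
    · rintro rfl; exact huv (hiu.symm.trans hjv)
    · rintro rfl
      have := hiu.symm.trans hkx
      apply h1; field_simp at this; linear_combination this
    · rintro rfl
      have := hjv.symm.trans hkx
      apply h2; field_simp at this; linear_combination this
  · rw [projPt_eq_conjPt, hconj]
    exact tripleCurve_eq_smul (by field_simp) (by field_simp; ring)

lemma le_three_mul_totalDegree {n : ℕ} (hn : 12 ≤ n) {F : MvPolynomial (Fin 3) ℂ} (hF0 : F ≠ 0)
    {e : ℕ} (hF : F.IsHomogeneous e) (h : ∀ p ∈ TriplePts n, eval (projPt p) F = 0) :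
    n ≤ 3 * F.totalDegree := by
  rw [hF.totalDegree hF0]
  by_contra! hlt
  refine hF0 (eq_zero_of_eval_tripleCurve_roots hF (n := n) (by omega)
    fun u v hu hv huv h1 h2 => ?_)
  obtain ⟨p, hp, hpe⟩ := exists_triplePt_of_pow_eq_one (by omega) hu hv huv h1 h2
  rw [hpe, hF.eval_mul, h p hp, mul_zero]

lemma elementary_symmetric_of_roots {z w u v x : ℂ} (huv : u ≠ v) (hux : u ≠ x) (hvx : v ≠ x)
    (hu : u ^ 3 - z * u ^ 2 + w * u - 1 = 0) (hv : v ^ 3 - z * v ^ 2 + w * v - 1 = 0)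
    (hx : x ^ 3 - z * x ^ 2 + w * x - 1 = 0) : z = u + v + x ∧ u * v * x = 1 := by
  have h1 : u ^ 2 + u * v + v ^ 2 - z * (u + v) + w = 0 :=
    mul_left_cancel₀ (sub_ne_zero.mpr huv) (by linear_combination hu - hv)
  have h2 : u ^ 2 + u * x + x ^ 2 - z * (u + x) + w = 0 :=
    mul_left_cancel₀ (sub_ne_zero.mpr hux) (by linear_combination hu - hx)
  have h3 : u + v + x - z = 0 :=
    mul_left_cancel₀ (sub_ne_zero.mpr hvx) (by linear_combination h1 - h2)
  refine ⟨by linear_combination -h3, ?_⟩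
  linear_combination hu - u * h1 - u * v * (-h3)

lemma exists_lt_lt_of_two_lt_ncard {S : Set ℕ} (hS : S.Finite) (h : 2 < S.ncard) :
    ∃ a ∈ S, ∃ b ∈ S, ∃ c ∈ S, a < b ∧ b < c := by
  obtain ⟨a, b, c, ha, hb, hc, hab, hac, hbc⟩ := (Set.two_lt_ncard_iff hS).mp h
  rcases lt_or_gt_of_ne hab with h1 | h1 <;> rcases lt_or_gt_of_ne hac with h2 | h2 <;>
    rcases lt_or_gt_of_ne hbc with h3 | h3
  · exact ⟨a, ha, b, hb, c, hc, h1, h3⟩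
  · exact ⟨a, ha, c, hc, b, hb, h2, h3⟩
  · omega
  · exact ⟨c, hc, a, ha, b, hb, h2, h1⟩
  · exact ⟨b, hb, a, ha, c, hc, h1, h2⟩
  · omega
  · exact ⟨b, hb, c, hc, a, ha, h3, h2⟩
  · exact ⟨c, hc, b, hb, a, ha, h3, h1⟩

lemma isMirrorOrRep_of_mem_TriplePts {m : ℕ} (hm : m ≠ 0) {p : ℂ} (hp : p ∈ TriplePts (6 * m)) :
    IsMirrorOrRep (Complex.exp (2 * Real.pi * I / (6 * m : ℕ))) m p ((starRingEnd ℂ) p) := by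
  have hn : 6 * m ≠ 0 := by omega
  obtain ⟨a, ⟨han, ha⟩, b, ⟨hbn, hb⟩, c, ⟨hcn, hc⟩, hab, hbc⟩ :=
    exists_lt_lt_of_two_lt_ncard ((Set.finite_Iio (6 * m)).subset fun a ha => ha.1) hp
  rw [mem_Bline_iff hn, Ppt_eq_pow] at ha hb hc
  have hprim := Complex.isPrimitiveRoot_exp (6 * m) hn
  have hconj := conj_eq_inv_of_pow_eq_one hn (root_pow_eq_one hn)
  generalize Complex.exp (2 * Real.pi * I / (6 * m : ℕ)) = ζ at *
  obtain ⟨hz, hprod⟩ := elementary_symmetric_of_roots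
    (fun h => hab.ne (hprim.pow_inj han hbn h)) (fun h => (hab.trans hbc).ne
      (hprim.pow_inj han hcn h)) (fun h => hbc.ne (hprim.pow_inj hbn hcn h)) ha hb hc
  rw [← pow_add, ← pow_add, hprim.pow_eq_one_iff_dvd] at hprod
  obtain ⟨k, hk⟩ := hprod
  have h := isMirrorOrRep_of_sum_eq (hprim.ne_zero hn) hprim.pow_eq_one (a := a) (b := b) (c := c)
    (k := k) (by omega) (by omega) (by omega) (by exact_mod_cast hk)
  convert h using 1
  · simp only [hz, zpowSum, zpow_natCast]
  · simp only [hz, zpowSum, map_add, map_pow, hconj, zpow_neg, zpow_natCast, inv_pow]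

/-- The exponents `(c, b)` with `2 * b + 3 * c ≤ d`. -/
def invariantExponents (d : ℕ) : Finset (Σ _ : ℕ, ℕ) :=
  (Finset.range (d / 3 + 1)).sigma fun c => Finset.range ((d - 3 * c) / 2 + 1)

lemma card_invariantExponents (d : ℕ) :
    (invariantExponents d).card = (d ^ 2 + 6 * d) / 12 + 1 := by
  rw [invariantExponents, Finset.card_sigma]
  simp only [Finset.card_range]
  induction d using Nat.strong_induction_on with
  | _ d ih =>
    by_cases hd : d < 6
    · interval_cases d <;> decide
    obtain ⟨k, rfl⟩ : ∃ k, d = k + 6 := ⟨d - 6, by omega⟩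
    rw [show (k + 6) / 3 + 1 = (k / 3 + 1) + 1 + 1 by omega, Finset.sum_range_succ',
      Finset.sum_range_succ']
    have h1 : ∀ c, (k + 6 - 3 * (c + 1 + 1)) / 2 + 1 = (k - 3 * c) / 2 + 1 := by
      intro c; omega
    simp only [h1]
    rw [ih k (by omega), show (k + 6) ^ 2 + 6 * (k + 6) = k ^ 2 + 6 * k + 12 * (k + 6) by ring]
    omega

lemma exists_ne_zero_sum_mul_eq_zero {ι κ : Type*} [Fintype ι] [Fintype κ]
    (h : Fintype.card κ < Fintype.card ι) (M : κ → ι → ℂ) :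
    ∃ c : ι → ℂ, c ≠ 0 ∧ ∀ r, ∑ i, M r i * c i = 0 := by
  have hker := LinearMap.ker_ne_bot_of_finrank_lt (f := Matrix.mulVecLin (Matrix.of M))
    (by simpa using h)
  obtain ⟨c, hc, hc0⟩ := (Submodule.ne_bot_iff _).mp hker
  exact ⟨c, hc0, fun r => congrFun (LinearMap.mem_ker.mp hc) r⟩

lemma exists_mul_eq_add_pow_three_eq (α β : ℂ) : ∃ z w : ℂ, z * w = α ∧ z ^ 3 + w ^ 3 = β := by
  by_cases hα : α = 0
  · obtain ⟨z, hz⟩ := IsAlgClosed.exists_pow_nat_eq β (n := 3) (by norm_num)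
    exact ⟨z, 0, by simp [hα], by simp [hz]⟩
  obtain ⟨y, hy⟩ := IsAlgClosed.exists_root
    (Polynomial.X ^ 2 - Polynomial.C β * Polynomial.X + Polynomial.C (α ^ 3)) (by
      have : (Polynomial.X ^ 2 - Polynomial.C β * Polynomial.X
        + Polynomial.C (α ^ 3) : Polynomial ℂ).degree = 2 := by compute_degree!
      rw [this]; norm_num)
  simp only [Polynomial.IsRoot, Polynomial.eval_sub, Polynomial.eval_add, Polynomial.eval_mul,
    Polynomial.eval_pow, Polynomial.eval_X, Polynomial.eval_C] at hy
  have hy0 : y ≠ 0 := by rintro rfl; simp [hα] at hy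
  obtain ⟨z, rfl⟩ := IsAlgClosed.exists_pow_nat_eq y (n := 3) (by norm_num)
  have hz0 : z ≠ 0 := by rintro rfl; simp at hy0
  refine ⟨z, α / z, by field_simp, ?_⟩
  field_simp
  linear_combination hy

/-- The linear form `x + iy`. -/
noncomputable def zForm : MvPolynomial (Fin 3) ℂ := X 0 + C I * X 1

/-- The linear form `x - iy`. -/
noncomputable def wForm : MvPolynomial (Fin 3) ℂ := X 0 - C I * X 1

lemma eval_zForm (z w t : ℂ) : eval (conjPt z w t) zForm = z := by
  simp [zForm, conjPt]; field_simp; ring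

lemma eval_wForm (z w t : ℂ) : eval (conjPt z w t) wForm = w := by
  simp [wForm, conjPt]; field_simp; ring

lemma isHomogeneous_zForm : zForm.IsHomogeneous 1 :=
  (isHomogeneous_X ℂ 0).add (isHomogeneous_C_mul_X I 1)

lemma isHomogeneous_wForm : wForm.IsHomogeneous 1 :=
  (isHomogeneous_X ℂ 0).sub (isHomogeneous_C_mul_X I 1)

/-- The degree `d` combination of dihedral invariants with coefficients `c`. -/
noncomputable def invariantForm (d : ℕ) (c : invariantExponents d → ℂ) :
    MvPolynomial (Fin 3) ℂ :=
  ∑ i, C (c i) * (X 2 ^ (d - 2 * i.1.2 - 3 * i.1.1) * (zForm * wForm) ^ i.1.2 *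
    (zForm ^ 3 + wForm ^ 3) ^ i.1.1)

lemma isHomogeneous_invariantForm (d : ℕ) (c : invariantExponents d → ℂ) :
    (invariantForm d c).IsHomogeneous d := by
  refine IsHomogeneous.sum _ _ _ fun i _ => IsHomogeneous.C_mul ?_ _
  have hi := i.2
  simp only [invariantExponents, Finset.mem_sigma, Finset.mem_range] at hi
  have h := ((isHomogeneous_X_pow (R := ℂ) (2 : Fin 3) (d - 2 * i.1.2 - 3 * i.1.1)).mul
    ((isHomogeneous_zForm.mul isHomogeneous_wForm).pow i.1.2)).mul
    (((isHomogeneous_zForm.pow 3).add (isHomogeneous_wForm.pow 3)).pow i.1.1)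
  convert h using 1
  omega

lemma eval_invariantForm (d : ℕ) (c : invariantExponents d → ℂ) (z w : ℂ) :
    eval (conjPt z w 1) (invariantForm d c) =
      ∑ i, (z * w) ^ i.1.2 * (z ^ 3 + w ^ 3) ^ i.1.1 * c i := by
  rw [invariantForm, map_sum]
  refine Finset.sum_congr rfl fun i _ => ?_
  simp only [map_mul, map_pow, map_add, eval_zForm, eval_wForm, eval_C, eval_X]
  simp [conjPt]; ring

lemma invariantForm_ne_zero {d : ℕ} {c : invariantExponents d → ℂ} (hc : c ≠ 0) :
    invariantForm d c ≠ 0 := by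
  intro h0
  let f : invariantExponents d → (Fin 2 →₀ ℕ) := fun i =>
    Finsupp.single 0 i.1.2 + Finsupp.single 1 i.1.1
  have hf : Function.Injective f := by
    intro i j hij
    have h1 := DFunLike.congr_fun hij 0
    have h2 := DFunLike.congr_fun hij 1
    simp [f] at h1 h2
    exact Subtype.ext (Sigma.ext h2 (heq_of_eq h1))
  have hli := Fintype.linearIndependent_iff.mp
    ((basisMonomials (Fin 2) ℂ).linearIndependent.comp f hf) c
  refine hc (funext (hli (MvPolynomial.funext fun x => ?_)))
  obtain ⟨z, w, hz, hw⟩ := exists_mul_eq_add_pow_three_eq (x 0) (x 1)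
  have h := eval_invariantForm d c z w
  rw [h0, map_zero, hz, hw] at h
  rw [map_zero, h, map_sum]
  refine Finset.sum_congr rfl fun i _ => ?_
  simp [f, smul_eval, eval_monomial, Finsupp.prod_fintype]
  ring

/-- Indices of the orbit representatives of triple points off the mirrors. -/
def orbitIndices (m : ℕ) : Finset (Σ _ : ℕ, ℕ) :=
  (Finset.range (m - 1)).sigma fun i => Finset.range (2 * i + 1)

lemma card_orbitIndices (m : ℕ) : (orbitIndices m).card = (m - 1) ^ 2 := by
  rw [orbitIndices, Finset.card_sigma]
  simp only [Finset.card_range]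
  induction m - 1 with
  | zero => rfl
  | succ k ih => rw [Finset.sum_range_succ, ih]; ring

lemma exists_form_vanishing_on_triplePts {m d : ℕ} (hm : m ≠ 0)
    (hd : (m - 1) ^ 2 ≤ (d ^ 2 + 6 * d) / 12) :
    ∃ F : MvPolynomial (Fin 3) ℂ, F ≠ 0 ∧ F.IsHomogeneous (3 + d) ∧
      ∀ p ∈ TriplePts (6 * m), eval (projPt p) F = 0 := by
  set ζ := Complex.exp (2 * Real.pi * I / (6 * m : ℕ))
  let rep : orbitIndices m → ℂ × ℂ := fun r =>
    let p : ℤ := r.1.2 + 1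
    let s : ℤ := m - 1 - r.1.1
    (zpowSum ζ (-(p + s)) (-s) (p + 2 * s), zpowSum ζ (p + s) s (-(p + 2 * s)))
  obtain ⟨c, hc, hM⟩ := exists_ne_zero_sum_mul_eq_zero (ι := invariantExponents d)
    (κ := orbitIndices m)
    (by rw [Fintype.card_coe, Fintype.card_coe, card_invariantExponents, card_orbitIndices]; omega)
    (fun r i => ((rep r).1 * (rep r).2) ^ i.1.2 * ((rep r).1 ^ 3 + (rep r).2 ^ 3) ^ i.1.1)
  refine ⟨(zForm ^ 3 - wForm ^ 3) * invariantForm d c,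
    mul_ne_zero (fun h => ?_) (invariantForm_ne_zero hc),
    ((isHomogeneous_zForm.pow 3).sub (isHomogeneous_wForm.pow 3)).mul
      (isHomogeneous_invariantForm d c), fun p hp => ?_⟩
  · have := congrArg (eval (conjPt 1 0 1)) h
    simp [eval_zForm, eval_wForm] at this
  · rw [projPt_eq_conjPt, map_mul, map_sub, map_pow, map_pow, eval_zForm, eval_wForm,
      eval_invariantForm]
    rcases isMirrorOrRep_of_mem_TriplePts hm hp with h | ⟨q, s, hq, hs, hqs, h1, h2⟩
    · rw [h, sub_self, zero_mul]
    · have hmem : (⟨(m - 1 - s).toNat, (q - 1).toNat⟩ : Σ _ : ℕ, ℕ) ∈ orbitIndices m := by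
        simp only [orbitIndices, Finset.mem_sigma, Finset.mem_range]
        omega
      have hr := hM ⟨_, hmem⟩
      have hq' : (((q - 1).toNat : ℕ) : ℤ) + 1 = q := by omega
      have hs' : (m : ℤ) - 1 - ((m - 1 - s).toNat : ℕ) = s := by omega
      simp only [rep, hq', hs'] at hr
      rw [h1, h2, hr, mul_zero]

/-- For `6 ∣ n`, `n ≥ 12`, and `d` the least natural number with
`⌊(d² + 6d)/12⌋ ≥ (n-6)²/36`: (i) every nonzero homogeneous form vanishing at
all triple points has degree at least `n/3` (i.e. `n ≤ 3·deg`); (ii) there is a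
nonzero homogeneous form of degree at most `d + 3` vanishing at all triple
points. Hence `n/3 ≤ α(I_n) ≤ d + 3`. -/
theorem boroczky_alpha_bounds (n : ℕ) (hn : 12 ≤ n) (hdvd : 6 ∣ n)
    (d : ℕ) (hd : (n - 6) ^ 2 / 36 ≤ (d ^ 2 + 6 * d) / 12)
    (hdmin : ∀ d' : ℕ, d' < d → ¬ ((n - 6) ^ 2 / 36 ≤ (d' ^ 2 + 6 * d') / 12)) :
    (∀ F : MvPolynomial (Fin 3) ℂ, F ≠ 0 → (∃ e, F.IsHomogeneous e) →
      (∀ p ∈ TriplePts n, eval (projPt p) F = 0) → n ≤ 3 * F.totalDegree) ∧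
    (∃ F : MvPolynomial (Fin 3) ℂ, F ≠ 0 ∧ (∃ e, e ≤ d + 3 ∧ F.IsHomogeneous e) ∧
      (∀ p ∈ TriplePts n, eval (projPt p) F = 0)) := by
  obtain ⟨m, rfl⟩ := hdvd
  refine ⟨fun F hF0 ⟨e, hF⟩ h => le_three_mul_totalDegree hn hF0 hF h, ?_⟩
  have hm : (6 * m - 6) ^ 2 / 36 = (m - 1) ^ 2 := by
    rw [show 6 * m - 6 = 6 * (m - 1) by omega, mul_pow]
    exact Nat.mul_div_cancel_left _ (by norm_num)
  rw [hm] at hd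
  obtain ⟨F, hF0, hF, h⟩ := exists_form_vanishing_on_triplePts (by omega) hd
  exact ⟨F, hF0, ⟨3 + d, (add_comm 3 d).le, hF⟩, h⟩
end
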